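/- Let V be a 4-dimensional complex vector space with a symplectic form ω, let L ⊆ V be a 1-dimensional subspace, and let S ⊆ V be a 2-dimensional subspace. Then S is Lagrangian and L ⊆ S if and only if the subspace Λ²S of Λ²V is contained in the subspace of Λ²V spanned by the elements l ∧ w with l ∈ L and w ∈ L^⊥. -/

import Mathlib

/-- An alternating bilinear form, regarded as an alternating map in two variables. -/
def LinearMap.BilinForm.IsAlt.toAlternatingMap {K V : Type*} [CommRing K] [AddCommGroup V]
    [Module K V] {B : LinearMap.BilinForm K V} (hB : B.IsAlt) : V [⋀^Fin 2]→ₗ[K] K where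
  toFun v := B (v 0) (v 1)
  map_update_add' v i x y := by
    fin_cases i <;> simp [Function.update]
  map_update_smul' v i c x := by
    fin_cases i <;> simp [Function.update]
  map_eq_zero_of_eq' v i j h hij := by
    fin_cases i <;> fin_cases j <;> simp_all [hB _]

/-- An alternating bilinear form factors through the exterior algebra. -/
theorem LinearMap.BilinForm.IsAlt.exists_exteriorAlgebra_lift {K V : Type*} [CommRing K]
    [AddCommGroup V] [Module K V] {B : LinearMap.BilinForm K V} (hB : B.IsAlt) :
    ∃ φ : ExteriorAlgebra K V →ₗ[K] K,
      ∀ x y, φ (ExteriorAlgebra.ι K x * ExteriorAlgebra.ι K y) = B x y := by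
  refine ⟨ExteriorAlgebra.liftAlternating (Pi.single 2 hB.toAlternatingMap), fun x y => ?_⟩
  have h := ExteriorAlgebra.liftAlternating_apply_ιMulti (R := K)
    (Pi.single 2 hB.toAlternatingMap) ![x, y]
  rw [Pi.single_eq_same] at h
  simpa [ExteriorAlgebra.ιMulti_apply, LinearMap.BilinForm.IsAlt.toAlternatingMap] using h

/-- If the wedges of `C` and `D` are contained in the span of the wedges of `A` and `A'`, then an
alternating form vanishing on `A × A'` also vanishes on `C × D`. -/
theorem LinearMap.BilinForm.IsAlt.eq_zero_of_span_wedge_le {K V : Type*} [CommRing K]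
    [AddCommGroup V] [Module K V] {B : LinearMap.BilinForm K V} (hB : B.IsAlt)
    {A A' C D : Set V}
    (h : Submodule.span K
          (Set.image2 (fun s t => ExteriorAlgebra.ι K s * ExteriorAlgebra.ι K t) C D) ≤
        Submodule.span K
          (Set.image2 (fun l w => ExteriorAlgebra.ι K l * ExteriorAlgebra.ι K w) A A'))
    (h0 : ∀ a ∈ A, ∀ a' ∈ A', B a a' = 0) {c d : V} (hc : c ∈ C) (hd : d ∈ D) : B c d = 0 := by
  obtain ⟨φ, hφ⟩ := hB.exists_exteriorAlgebra_lift
  have hle : Submodule.span K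
      (Set.image2 (fun l w => ExteriorAlgebra.ι K l * ExteriorAlgebra.ι K w) A A') ≤
        LinearMap.ker φ := by
    rw [Submodule.span_le]
    rintro _ ⟨a, ha, a', ha', rfl⟩
    simpa [hφ] using h0 a ha a' ha'
  rw [← hφ]
  exact hle (h (Submodule.subset_span ⟨c, hc, d, hd, rfl⟩))

theorem stmt_7 (V : Type*) [AddCommGroup V] [Module ℂ V] [FiniteDimensional ℂ V]
    (hV : Module.finrank ℂ V = 4)
    (ω : LinearMap.BilinForm ℂ V) (halt : ω.IsAlt) (hnd : ω.Nondegenerate)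
    (L S : Submodule ℂ V)
    (hL : Module.finrank ℂ L = 1) (hS : Module.finrank ℂ S = 2) :
    (S = ω.orthogonal S ∧ L ≤ S) ↔
      Submodule.span ℂ
          (Set.image2 (fun s t => ExteriorAlgebra.ι ℂ s * ExteriorAlgebra.ι ℂ t)
            (S : Set V) (S : Set V)) ≤
        Submodule.span ℂ
          (Set.image2 (fun l w => ExteriorAlgebra.ι ℂ l * ExteriorAlgebra.ι ℂ w)
            (L : Set V) ((ω.orthogonal L : Submodule ℂ V) : Set V)) := by
  obtain ⟨w, hwS, hwL⟩ : ∃ w ∈ S, w ∉ L := by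
    by_contra! h
    have := Submodule.finrank_mono (show S ≤ L from h)
    omega
  constructor
  · rintro ⟨hSS, hLS⟩
    have hSL : S ≤ ω.orthogonal L := hSS.le.trans (LinearMap.BilinForm.orthogonal_le hLS)
    have hsup : L ⊔ Submodule.span ℂ {w} = S := by
      refine Submodule.eq_of_le_of_finrank_le
        (sup_le hLS ((Submodule.span_singleton_le_iff_mem _ _).2 hwS)) ?_
      have hlt : L < L ⊔ Submodule.span ℂ {w} := by
        refine lt_of_le_of_ne le_sup_left fun h => hwL ?_
        rw [h]
        exact Submodule.mem_sup_right (Submodule.mem_span_singleton_self w)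
      have := Submodule.finrank_lt_finrank_of_lt hlt
      omega
    rw [Submodule.span_le]
    rintro _ ⟨s, hs, t, ht, rfl⟩
    obtain ⟨a, ha, x, hx, rfl⟩ := Submodule.mem_sup.1 (hsup.ge hs)
    obtain ⟨b, rfl⟩ := Submodule.mem_span_singleton.1 hx
    obtain ⟨c, hc, y, hy, rfl⟩ := Submodule.mem_sup.1 (hsup.ge ht)
    obtain ⟨d, rfl⟩ := Submodule.mem_span_singleton.1 hy
    have hwc : ExteriorAlgebra.ι ℂ w * ExteriorAlgebra.ι ℂ c =
        -(ExteriorAlgebra.ι ℂ c * ExteriorAlgebra.ι ℂ w) :=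
      eq_neg_of_add_eq_zero_left (ExteriorAlgebra.ι_add_mul_swap w c)
    have key : ExteriorAlgebra.ι ℂ (a + b • w) * ExteriorAlgebra.ι ℂ (c + d • w) =
        ExteriorAlgebra.ι ℂ a * ExteriorAlgebra.ι ℂ (c + d • w) -
          b • (ExteriorAlgebra.ι ℂ c * ExteriorAlgebra.ι ℂ w) := by
      simp only [map_add, map_smul, add_mul, mul_add, smul_mul_assoc, mul_smul_comm, hwc,
        ExteriorAlgebra.ι_sq_zero, smul_zero, add_zero, smul_neg]
      abel
    simp only [SetLike.mem_coe, key]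
    exact Submodule.sub_mem _ (Submodule.subset_span ⟨a, ha, _, hSL ht, rfl⟩)
      (Submodule.smul_mem _ _ (Submodule.subset_span ⟨c, hc, w, hSL hwS, rfl⟩))
  · intro h
    constructor
    · refine Submodule.eq_of_le_of_finrank_eq (fun t ht s hs => ?_) ?_
      · exact halt.eq_zero_of_span_wedge_le h (fun l hl x hx => hx l hl) hs ht
      · rw [LinearMap.BilinForm.finrank_orthogonal hnd, hV, hS]
    · by_contra hLS
      obtain ⟨s, hsS, hs⟩ : ∃ s ∈ S, s ∉ L ⊔ Submodule.span ℂ {w} := by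
        by_contra! hle
        refine hLS ?_
        have h1 := Submodule.finrank_add_le_finrank_add_finrank L (Submodule.span ℂ {w})
        have h2 := finrank_span_singleton (K := ℂ) (v := w) fun h0 => hwL (h0 ▸ L.zero_mem)
        rw [Submodule.eq_of_le_of_finrank_le (show S ≤ L ⊔ Submodule.span ℂ {w} from hle)
          (by omega)]
        exact le_sup_left
      obtain ⟨f, hfs, hf⟩ := Submodule.exists_le_ker_of_notMem hs
      obtain ⟨g, hgw, hg⟩ := Submodule.exists_le_ker_of_notMem hwL
      have hfL : ∀ l ∈ L, f l = 0 := fun l hl => hf (Submodule.mem_sup_left hl)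
      have hfw : f w = 0 := hf (Submodule.mem_sup_right (Submodule.mem_span_singleton_self w))
      let B : LinearMap.BilinForm ℂ V :=
        (LinearMap.mul ℂ ℂ).compl₁₂ f g - (LinearMap.mul ℂ ℂ).compl₁₂ g f
      have hB : B.IsAlt := fun x => by simp [B, mul_comm]
      have : B s w = 0 := hB.eq_zero_of_span_wedge_le h
        (fun l hl x _ => by simp [B, hfL l hl, show g l = 0 from hg hl]) hsS hwS
      simp [B, hfw, hfs, hgw] at this
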